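/- Fix λ ∈ ℂ with λ ≠ 0, let R = P/Q be a non-constant rational function (P, Q ∈ ℂ[X] coprime, Q ≠ 0, max(deg P, deg Q) ≥ 1), and let a, b ∈ ℂ with a ≠ 0 and b ≠ a. If R and ∂_z R share the value a CM in ℂ* and share the value b in ℂ*, then P·Q = λ·X·(P'·Q − P·Q') in ℂ[X] (i.e., R ≡ ∂_z R). -/

import Mathlib

open Polynomial

/-- The coefficients of the Euler derivative of a polynomial. -/
theorem coeff_X_mul_derivative (P : ℂ[X]) (i : ℕ) :
    (X * derivative P).coeff i = i * P.coeff i := by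
  cases i with
  | zero => simp
  | succ n => rw [coeff_X_mul, coeff_derivative]; push_cast; ring

theorem natDegree_X_mul_derivative_le (P : ℂ[X]) : (X * derivative P).natDegree ≤ P.natDegree := by
  refine natDegree_le_iff_coeff_eq_zero.2 fun i hi => ?_
  rw [coeff_X_mul_derivative, coeff_eq_zero_of_natDegree_lt hi, mul_zero]

/-- A lower bound for the degree of the numerator of `l X ∂(P/Q) - a`. -/
theorem natDegree_le_natDegree_euler_sub {l a : ℂ} (hl : l ≠ 0) (ha : a ≠ 0) (P : ℂ[X])
    {Q : ℂ[X]} (hQ : Q ≠ 0) :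
    Q.natDegree + max P.natDegree Q.natDegree ≤
      (C l * X * (derivative P * Q - P * derivative Q) - C a * Q ^ 2).natDegree := by
  have hQc : Q.coeff Q.natDegree ≠ 0 := by simpa using hQ
  have key : C l * X * (derivative P * Q - P * derivative Q) - C a * Q ^ 2 =
      C l * ((X * derivative P) * Q - P * (X * derivative Q)) - C a * (Q * Q) := by ring
  rw [key]
  apply le_natDegree_of_ne_zero
  rcases le_or_gt P.natDegree Q.natDegree with h | h
  · rw [max_eq_right h, coeff_sub, coeff_C_mul, coeff_C_mul, coeff_sub,
      coeff_mul_add_eq_of_natDegree_le ((natDegree_X_mul_derivative_le P).trans h) le_rfl,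
      coeff_mul_add_eq_of_natDegree_le h (natDegree_X_mul_derivative_le Q),
      coeff_mul_add_eq_of_natDegree_le le_rfl le_rfl, coeff_X_mul_derivative, coeff_X_mul_derivative]
    have : l * (Q.natDegree * P.coeff Q.natDegree * Q.coeff Q.natDegree -
        P.coeff Q.natDegree * (Q.natDegree * Q.coeff Q.natDegree)) -
        a * (Q.coeff Q.natDegree * Q.coeff Q.natDegree) =
        -(a * (Q.coeff Q.natDegree * Q.coeff Q.natDegree)) := by ring
    rw [this]
    exact neg_ne_zero.2 (mul_ne_zero ha (mul_ne_zero hQc hQc))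
  · have hPc : P.coeff P.natDegree ≠ 0 := by
      have : P ≠ 0 := by rintro rfl; simp at h
      simpa using this
    have hQQ : (Q * Q).natDegree < P.natDegree + Q.natDegree :=
      natDegree_mul_le.trans_lt (by omega)
    rw [max_eq_left h.le, add_comm Q.natDegree, coeff_sub, coeff_C_mul, coeff_C_mul, coeff_sub,
      coeff_mul_add_eq_of_natDegree_le (natDegree_X_mul_derivative_le P) le_rfl,
      coeff_mul_add_eq_of_natDegree_le le_rfl (natDegree_X_mul_derivative_le Q),
      coeff_eq_zero_of_natDegree_lt hQQ, coeff_X_mul_derivative, coeff_X_mul_derivative]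
    have : l * (P.natDegree * P.coeff P.natDegree * Q.coeff Q.natDegree -
        P.coeff P.natDegree * (Q.natDegree * Q.coeff Q.natDegree)) - a * 0 =
        l * (((P.natDegree : ℂ) - Q.natDegree) *
          (P.coeff P.natDegree * Q.coeff Q.natDegree)) := by ring
    rw [this]
    refine mul_ne_zero hl (mul_ne_zero (sub_ne_zero.2 ?_) (mul_ne_zero hPc hQc))
    exact_mod_cast h.ne'

theorem ne_C_mul_of_isCoprime {P Q : ℂ[X]} (hPQ : IsCoprime P Q)
    (hd : 1 ≤ max P.natDegree Q.natDegree) (t : ℂ) : P ≠ C t * Q := by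
  intro h
  have hu : IsUnit Q := hPQ.isUnit_of_dvd' (h ▸ dvd_mul_left Q (C t)) dvd_rfl
  have hQ0 := natDegree_eq_zero_of_isUnit hu
  have hP0 : P.natDegree ≤ 0 := by
    rw [h, ← hQ0]
    exact natDegree_C_mul_le t Q
  omega

theorem exists_ne_zero_mul_pow_eq {i k : ℕ} (hik : i ≠ k) {u v : ℂ} (hu : u ≠ 0) (hv : v ≠ 0) :
    ∃ w : ℂ, w ≠ 0 ∧ u * w ^ i = v * w ^ k := by
  wlog h : k < i generalizing i k u v
  · obtain ⟨w, hw, e⟩ := this hik.symm hv hu (by omega)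
    exact ⟨w, hw, e.symm⟩
  obtain ⟨w, hw⟩ := IsAlgClosed.exists_pow_nat_eq (v / u) (Nat.sub_pos_of_lt h)
  refine ⟨w, ?_, ?_⟩
  · rintro rfl
    rw [zero_pow (Nat.sub_pos_of_lt h).ne'] at hw
    exact div_ne_zero hv hu hw.symm
  · rw [← Nat.sub_add_cancel h.le, pow_add, hw]
    field_simp

/-- The numerator of `l X ∂(P/Q) - a` for `Q = X ^ k * S`, divided by `X ^ k`. -/
noncomputable def reducedNumerator (l a : ℂ) (k : ℕ) (P S : ℂ[X]) : ℂ[X] :=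
  C l * (X * derivative P * S - P * (C (k : ℂ) * S + X * derivative S)) - C a * X ^ k * S ^ 2

theorem X_pow_mul_reducedNumerator (l a : ℂ) (k : ℕ) (P S : ℂ[X]) :
    C l * X * (derivative P * (X ^ k * S) - P * derivative (X ^ k * S)) - C a * (X ^ k * S) ^ 2 =
      X ^ k * reducedNumerator l a k P S := by
  have : X * derivative (X ^ k * S) = X ^ k * (C (k : ℂ) * S + X * derivative S) := by
    rw [derivative_mul, derivative_X_pow]
    cases k with
    | zero => simp
    | succ n => simp only [Nat.add_sub_cancel]; ring
  rw [reducedNumerator]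
  linear_combination (-(C l * P)) * this

theorem eval_zero_reducedNumerator_ne_zero {l a : ℂ} (hl : l ≠ 0) (ha : a ≠ 0) {k : ℕ}
    {P S : ℂ[X]} (hPQ : IsCoprime P (X ^ k * S)) (hS : S.eval 0 ≠ 0) :
    (reducedNumerator l a k P S).eval 0 ≠ 0 := by
  rcases Nat.eq_zero_or_pos k with rfl | hk
  · simp [reducedNumerator, ha, hS]
  · have hP : P.eval 0 ≠ 0 := by
      obtain ⟨u, v, h⟩ := hPQ
      intro h0
      have := congrArg (eval 0) h
      simp [h0, hk.ne'] at this
    simp [reducedNumerator, hl, hS, hP, hk.ne']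

theorem rootMultiplicity_reducedNumerator_le {l a : ℂ} (hl : l ≠ 0) {k : ℕ}
    {P S : ℂ[X]} (hPQ : IsCoprime P (X ^ k * S)) (hS : S.eval 0 ≠ 0)
    (hS' : derivative S ≠ 0) (hH : reducedNumerator l a k P S ≠ 0) {w : ℂ} (hw : S.IsRoot w) :
    (reducedNumerator l a k P S).rootMultiplicity w ≤ (derivative S).rootMultiplicity w := by
  have hS0 : S ≠ 0 := by rintro rfl; simp at hS
  have hw0 : w ≠ 0 := by rintro rfl; exact hS hw
  have hP : P.eval w ≠ 0 := by
    obtain ⟨u, v, h⟩ := hPQ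
    intro h0
    have := congrArg (eval w) h
    simp [h0, hw.eq_zero] at this
  have he : 0 < S.rootMultiplicity w := (rootMultiplicity_pos hS0).2 hw
  have hd := derivative_rootMultiplicity_of_root hw
  by_contra! hlt
  have h1 : (X - C w) ^ S.rootMultiplicity w ∣ reducedNumerator l a k P S :=
    (le_rootMultiplicity_iff hH).1 (by omega)
  have h2 : (X - C w) ^ S.rootMultiplicity w ∣ S := pow_rootMultiplicity_dvd S w
  have h3 : (X - C w) ^ S.rootMultiplicity w ∣ (C l * X * P) * derivative S := by
    have e : (C l * X * P) * derivative S =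
        S * (C l * (X * derivative P - P * C (k : ℂ)) - C a * X ^ k * S) -
          reducedNumerator l a k P S := by
      rw [reducedNumerator]; ring
    rw [e]
    exact dvd_sub (h2.mul_right _) h1
  have h4 := (prime_X_sub_C w).pow_dvd_of_dvd_mul_left _
    (by rw [dvd_iff_isRoot]; simp [hl, hw0, hP]) h3
  have h5 := (le_rootMultiplicity_iff hS').2 h4
  omega

/-- If all zeros of `H` off the zeros of `S` are zeros of `F` of at least the
same order and `T` accounts for the others, then `H` divides `F * T`. -/
theorem dvd_mul_of_rootMultiplicity_le {H F S T : ℂ[X]} (hH : H ≠ 0) (hF : F ≠ 0) (hT : T ≠ 0)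
    (h1 : ∀ w, S.eval w ≠ 0 → H.rootMultiplicity w ≤ F.rootMultiplicity w)
    (h2 : ∀ w, S.IsRoot w → H.rootMultiplicity w ≤ T.rootMultiplicity w) : H ∣ F * T := by
  have hFT := mul_ne_zero hF hT
  refine (IsAlgClosed.splits H).dvd_of_roots_le_roots hH ?_
  refine Multiset.le_iff_count.2 fun w => ?_
  rw [count_roots, count_roots, rootMultiplicity_mul hFT]
  by_cases hw : S.IsRoot w
  · exact (h2 w hw).trans (Nat.le_add_left _ _)
  · exact (h1 w hw).trans (Nat.le_add_right _ _)

/-- Sharing a nonzero value CM forces `P/Q` to be a Laurent polynomial, and its Euler derivative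
minus `a` to be a constant multiple of `P/Q - a`. -/
theorem exists_reducedNumerator_eq_C_mul {l a : ℂ} (hl : l ≠ 0) (ha : a ≠ 0) {k : ℕ} {P S : ℂ[X]}
    (hPQ : IsCoprime P (X ^ k * S)) (hS : S.eval 0 ≠ 0)
    (hd : 1 ≤ max P.natDegree (X ^ k * S).natDegree)
    (hCM : ∀ w : ℂ, w ≠ 0 → (X ^ k * S).eval w ≠ 0 →
      rootMultiplicity w (P - C a * (X ^ k * S)) =
        rootMultiplicity w (C l * X * (derivative P * (X ^ k * S) - P * derivative (X ^ k * S)) -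
          C a * (X ^ k * S) ^ 2)) :
    ∃ s c : ℂ, S = C s ∧ reducedNumerator l a k P S = C c * (P - C a * (X ^ k * S)) := by
  have hS0 : S ≠ 0 := by rintro rfl; simp at hS
  have hXk : (X ^ k : ℂ[X]) ≠ 0 := pow_ne_zero _ X_ne_zero
  have hQ : X ^ k * S ≠ 0 := mul_ne_zero hXk hS0
  have hH0 := eval_zero_reducedNumerator_ne_zero hl ha hPQ hS
  have hdeg := natDegree_le_natDegree_euler_sub hl ha P hQ
  rw [X_pow_mul_reducedNumerator] at hdeg
  simp only [X_pow_mul_reducedNumerator] at hCM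
  set H := reducedNumerator l a k P S
  have hH : H ≠ 0 := by
    intro h
    rw [h] at hH0
    simp at hH0
  have hF : P - C a * (X ^ k * S) ≠ 0 := sub_ne_zero.2 (ne_C_mul_of_isCoprime hPQ hd a)
  have hFdeg : (P - C a * (X ^ k * S)).natDegree ≤ max P.natDegree (X ^ k * S).natDegree :=
    (natDegree_sub_le _ _).trans (max_le_max le_rfl (natDegree_C_mul_le _ _))
  have h1 : ∀ w, S.eval w ≠ 0 →
      H.rootMultiplicity w ≤ (P - C a * (X ^ k * S)).rootMultiplicity w := by
    intro w hw
    by_cases hw0 : w = 0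
    · subst hw0
      rw [rootMultiplicity_eq_zero hH0]
      exact Nat.zero_le _
    · rw [hCM w hw0 (by simp [hw0, hw]), rootMultiplicity_mul (mul_ne_zero hXk hH)]
      exact Nat.le_add_left _ _
  have hdegH : S.natDegree + max P.natDegree (X ^ k * S).natDegree ≤ H.natDegree := by
    rw [natDegree_mul hXk hH] at hdeg
    have := natDegree_mul hXk hS0
    omega
  have hSder : derivative S = 0 := by
    by_contra hS'
    have hdvd := dvd_mul_of_rootMultiplicity_le hH hF hS' h1
      fun w hw => rootMultiplicity_reducedNumerator_le hl hPQ hS hS' hH hw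
    have hle := natDegree_le_of_dvd hdvd (mul_ne_zero hF hS')
    rw [natDegree_mul hF hS'] at hle
    have hlt := natDegree_derivative_lt (p := S) (by
      intro h
      rw [eq_C_of_natDegree_eq_zero h] at hS'
      simp at hS')
    omega
  obtain ⟨s, rfl⟩ : ∃ s, S = C s := ⟨_, eq_C_of_derivative_eq_zero hSder⟩
  have hs : s ≠ 0 := by simpa using hS
  obtain ⟨T, hT⟩ := dvd_mul_of_rootMultiplicity_le hH hF one_ne_zero h1
    (fun w hw => absurd hw (by simp [hs]))
  rw [mul_one] at hT
  have hT0 : T ≠ 0 := by rintro rfl; exact hF (by simpa using hT)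
  have hTdeg : T.natDegree = 0 := by
    rw [hT, natDegree_mul hH hT0] at hFdeg
    omega
  obtain ⟨t, rfl⟩ : ∃ t, T = C t := ⟨_, eq_C_of_natDegree_eq_zero hTdeg⟩
  have ht : t ≠ 0 := by simpa using hT0
  refine ⟨s, t⁻¹, rfl, ?_⟩
  rw [hT, mul_comm H, ← mul_assoc, ← C_mul, inv_mul_cancel₀ ht, C_1, one_mul]

/-- If the reduced numerator is a constant multiple of `P - a Q` with `Q` a monomial, then `P/Q` is
a monomial plus a constant. -/
theorem exists_eq_monomial_add_of_reducedNumerator_eq {l a s c : ℂ} (hl : l ≠ 0) (hs : s ≠ 0)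
    {k : ℕ} {P : ℂ[X]} (hP : ∀ t : ℂ, P ≠ C t * (X ^ k * C s))
    (h : reducedNumerator l a k P (C s) = C c * (P - C a * (X ^ k * C s))) :
    ∃ (i : ℕ) (A B : ℂ), i ≠ k ∧ A ≠ 0 ∧ P = C A * X ^ i + C B * X ^ k ∧
      c = l * s * (i - k) ∧ c * B = a * s * (c - s) := by
  have hc : ∀ j, l * s * (j - k) * P.coeff j - a * s ^ 2 * (if j = k then 1 else 0) =
      c * (P.coeff j - a * s * (if j = k then 1 else 0)) := by
    intro j
    have e : reducedNumerator l a k P (C s) =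
        C (l * s) * (X * derivative P) - C (l * s * k) * P - C (a * s ^ 2) * X ^ k := by
      simp only [reducedNumerator, derivative_C, C_mul, C_pow]; ring
    have e' : C c * (P - C a * (X ^ k * C s)) = C c * (P - C (a * s) * X ^ k) := by
      simp only [C_mul]; ring
    rw [e, e'] at h
    have := congrArg (fun p => coeff p j) h
    simp only [coeff_sub, coeff_C_mul, coeff_X_mul_derivative, coeff_X_pow] at this
    linear_combination this
  obtain ⟨i, hik, hi⟩ : ∃ i, i ≠ k ∧ P.coeff i ≠ 0 := by
    by_contra! hall
    refine hP (P.coeff k / s) ?_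
    ext j
    have e : C (P.coeff k / s) * (X ^ k * C s) = C (P.coeff k) * X ^ k := by
      rw [mul_comm (X ^ k), ← mul_assoc, ← C_mul, div_mul_cancel₀ _ hs]
    rw [e, coeff_C_mul, coeff_X_pow]
    by_cases hj : j = k
    · simp [hj]
    · simp [hj, hall j hj]
  have hcval : ∀ j, j ≠ k → P.coeff j ≠ 0 → c = l * s * (j - k) := by
    intro j hj hPj
    have := hc j
    simp only [hj, if_false, mul_zero, sub_zero] at this
    exact (mul_right_cancel₀ hPj this).symm
  refine ⟨i, P.coeff i, P.coeff k, hik, hi, ?_, hcval i hik hi, ?_⟩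
  · ext j
    rw [coeff_add, coeff_C_mul, coeff_C_mul, coeff_X_pow, coeff_X_pow]
    by_cases hj : j = k
    · subst hj; simp [hik.symm]
    · by_cases hji : j = i
      · subst hji; simp [hik]
      · have : P.coeff j = 0 := by
          by_contra hPj
          have e := (hcval j hj hPj).symm.trans (hcval i hik hi)
          have e2 := mul_left_cancel₀ (mul_ne_zero hl hs) e
          exact hji (by exact_mod_cast sub_left_injective e2)
        simp [hj, hji, this]
  · have := hc k
    simp only [if_true, sub_self, mul_zero, zero_mul, mul_one] at this
    linear_combination -this

/-- If a non-constant rational function `R = P/Q` and `∂_z R` share a finite value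
`a ≠ 0` CM in `ℂ*` and share a second finite value `b` in `ℂ*`, then `R ≡ ∂_z R`. -/
theorem R_dzR_share_aCM_bIM_in_Cstar
    (l : ℂ) (hl : l ≠ 0)
    (P Q : ℂ[X]) (hPQ : IsCoprime P Q) (hQ : Q ≠ 0)
    (hd : 1 ≤ max P.natDegree Q.natDegree)
    (a b : ℂ) (ha : a ≠ 0) (hab : b ≠ a)
    (hsharea : ∀ w : ℂ, w ≠ 0 → Q.eval w ≠ 0 →
      (P.eval w = a * Q.eval w ↔
        l * w * (derivative P * Q - P * derivative Q).eval w = a * (Q.eval w) ^ 2))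
    (hCM : ∀ w : ℂ, w ≠ 0 → Q.eval w ≠ 0 →
      rootMultiplicity w (P - C a * Q) =
        rootMultiplicity w
          (C l * X * (derivative P * Q - P * derivative Q) - C a * Q ^ 2))
    (hshareb : ∀ w : ℂ, w ≠ 0 → Q.eval w ≠ 0 →
      (P.eval w = b * Q.eval w ↔
        l * w * (derivative P * Q - P * derivative Q).eval w = b * (Q.eval w) ^ 2)) :
    P * Q = C l * X * (derivative P * Q - P * derivative Q) := by
  obtain ⟨k, S, hS, rfl⟩ : ∃ (k : ℕ) (S : ℂ[X]), S.eval 0 ≠ 0 ∧ Q = X ^ k * S := by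
    obtain ⟨S, h1, h2⟩ := exists_eq_pow_rootMultiplicity_mul_and_not_dvd Q hQ 0
    rw [dvd_iff_isRoot] at h2
    exact ⟨_, S, h2, by simpa using h1⟩
  obtain ⟨s, c, rfl, hc⟩ := exists_reducedNumerator_eq_C_mul hl ha hPQ hS hd hCM
  have hs : s ≠ 0 := by simpa using hS
  obtain ⟨i, A, B, hik, hA, rfl, hci, hcB⟩ := exists_eq_monomial_add_of_reducedNumerator_eq hl hs
    (ne_C_mul_of_isCoprime hPQ hd) hc
  have hrel := X_pow_mul_reducedNumerator l a k (C A * X ^ i + C B * X ^ k) (C s)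
  rw [hc] at hrel
  have hc0 : c ≠ 0 := by
    rw [hci]
    refine mul_ne_zero (mul_ne_zero hl hs) (sub_ne_zero.2 ?_)
    exact_mod_cast hik
  have hcs : c = s := by
    by_contra hne
    have hrelw : ∀ w : ℂ, l * w * (derivative (C A * X ^ i + C B * X ^ k) * (X ^ k * C s) -
        (C A * X ^ i + C B * X ^ k) * derivative (X ^ k * C s)).eval w =
        a * (w ^ k * s) ^ 2 + w ^ k * (c * (A * w ^ i + B * w ^ k - a * (w ^ k * s))) := by
      intro w
      have := congrArg (eval w) hrel
      rw [eval_sub, eval_mul, eval_mul] at this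
      simp only [eval_C, eval_X, eval_mul, eval_pow, eval_sub (C A * X ^ i + C B * X ^ k),
        eval_add] at this
      linear_combination this
    simp only [hrelw] at hshareb
    simp only [eval_add, eval_mul, eval_C, eval_pow, eval_X] at hshareb
    by_cases hB : B = b * s
    · subst hB
      have hb : b ≠ 0 := by
        rintro rfl
        have : a * s * (c - s) = 0 := by rw [← hcB]; ring
        exact mul_ne_zero (mul_ne_zero ha hs) (sub_ne_zero.2 hne) this
      obtain ⟨w, hw, e⟩ := exists_ne_zero_mul_pow_eq hik (mul_ne_zero hc0 hA)
        (mul_ne_zero hb (pow_ne_zero 2 hs))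
      have := (hshareb w hw (mul_ne_zero (pow_ne_zero k hw) hs)).2
        (by linear_combination w ^ k * e + w ^ k * w ^ k * hcB)
      exact mul_ne_zero hA (pow_ne_zero i hw) (by linear_combination this)
    · obtain ⟨w, hw, e⟩ := exists_ne_zero_mul_pow_eq hik hA
        (v := b * s - B) (sub_ne_zero.2 (Ne.symm hB))
      have := (hshareb w hw (mul_ne_zero (pow_ne_zero k hw) hs)).1 (by linear_combination e)
      have h0 : (w ^ k) ^ 2 * s * ((c - s) * (b - a)) = 0 := by
        linear_combination this - w ^ k * c * e
      exact mul_ne_zero (mul_ne_zero (pow_ne_zero 2 (pow_ne_zero k hw)) hs)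
        (mul_ne_zero (sub_ne_zero.2 hne) (sub_ne_zero.2 hab)) h0
  subst hcs
  linear_combination -hrel
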